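/- Let w be a C² function of (x,t) on an open subset of (ℝ³ \ {0}) × ℝ. Then at every point of its domain, with summation over 1 ≤ k < l ≤ 3 and writing r = |x|, w_t = ∂_t w, w_r = ∂_r w, w_{tt} = ∂_t∂_t w, w_{rr} = ∂_r∂_r w: 2 w_t ( w_{tt} − w_{rr} − r^{-2} Ω w + w ) = ∂_t ( w² + w_t² + w_r² + r^{-2} Σ (Ω_{kl} w)² ) − 2 ∂_r ( w_t w_r ) − 2 r^{-2} Σ Ω_{kl} ( w_t Ω_{kl} w ), where all derivatives ∂_r and Ω_{kl} act in the spatial variable x with t fixed. -/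

import Mathlib

noncomputable section

open Real MeasureTheory Metric Set

/-- Euclidean 3-space. -/
abbrev E3 : Type := EuclideanSpace ℝ (Fin 3)

/-- The `i`-th standard basis vector of `ℝ³`. -/
def basis3 (i : Fin 3) : E3 := EuclideanSpace.single i 1

/-- The partial derivative `∂ᵢ f` of a function on `ℝ³`. -/
def pd (i : Fin 3) (f : E3 → ℝ) (x : E3) : ℝ := fderiv ℝ f x (basis3 i)

/-- The Laplacian `Δf` on `ℝ³`. -/
def lap (f : E3 → ℝ) (x : E3) : ℝ := ∑ i, pd i (pd i f) x

/-- The radial derivative `∂_r f(x) = (x/|x|)·∇f(x)`. -/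
def pdr (f : E3 → ℝ) (x : E3) : ℝ := ‖x‖⁻¹ * ∑ i, x i * pd i f x

/-- The angular derivative `Ω_{ij} f = xᵢ ∂ⱼ f − xⱼ ∂ᵢ f`. -/
def ang (i j : Fin 3) (f : E3 → ℝ) (x : E3) : ℝ := x i * pd j f x - x j * pd i f x

/-- `Ω f = Σ_{i<j} Ω_{ij}(Ω_{ij} f)`. -/
def angLap (f : E3 → ℝ) (x : E3) : ℝ :=
  ∑ i, ∑ j, if i < j then ang i j (ang i j f) x else 0

/-- The squared length `|∇f(x)|²` of the gradient. -/
def gradsq (f : E3 → ℝ) (x : E3) : ℝ := ∑ i, (pd i f x) ^ 2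

/-- `Σ_{i<j} (Ω_{ij} g)²`. -/
def angsq (g : E3 → ℝ) (x : E3) : ℝ := ∑ i, ∑ j, if i < j then (ang i j g x) ^ 2 else 0

/-- `Σ_{i<j} Σ_{k<l} (Ω_{kl} Ω_{ij} g)²`. -/
def angsq2 (g : E3 → ℝ) (x : E3) : ℝ :=
  ∑ i, ∑ j, ∑ k, ∑ l, if i < j ∧ k < l then (ang k l (ang i j g) x) ^ 2 else 0

/-- The time derivative `∂_t u` of a space-time function. -/
def pdt (u : E3 × ℝ → ℝ) (p : E3 × ℝ) : ℝ := fderiv ℝ u p (0, 1)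

/-- The spatial slice `x ↦ u(x,t)` of a space-time function, at fixed time `t`. -/
def fixT (u : E3 × ℝ → ℝ) (t : ℝ) : E3 → ℝ := fun y => u (y, t)

/-- The spatial partial derivative `∂ᵢ u` of a space-time function (`t` fixed). -/
def pdx (i : Fin 3) (u : E3 × ℝ → ℝ) (p : E3 × ℝ) : ℝ := pd i (fixT u p.2) p.1

/-- The spatial radial derivative `∂_r u` of a space-time function (`t` fixed). -/
def pdrX (u : E3 × ℝ → ℝ) (p : E3 × ℝ) : ℝ := pdr (fixT u p.2) p.1

/-- The spatial angular derivative `Ω_{ij} u` of a space-time function (`t` fixed). -/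
def angX (i j : Fin 3) (u : E3 × ℝ → ℝ) (p : E3 × ℝ) : ℝ := ang i j (fixT u p.2) p.1

/-- The spatial operator `Ω u` of a space-time function (`t` fixed). -/
def angLapX (u : E3 × ℝ → ℝ) (p : E3 × ℝ) : ℝ := angLap (fixT u p.2) p.1

/-- The spatial Laplacian `Δu` of a space-time function (`t` fixed). -/
def lapX (u : E3 × ℝ → ℝ) (p : E3 × ℝ) : ℝ := lap (fixT u p.2) p.1

/-- The squared spatial gradient `|∇u|²` of a space-time function (`t` fixed). -/
def gradsqX (u : E3 × ℝ → ℝ) (p : E3 × ℝ) : ℝ := gradsq (fixT u p.2) p.1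

/-- `Σ_{i<j} (Ω_{ij} w)²` for a space-time function (`t` fixed). -/
def angsqX (w : E3 × ℝ → ℝ) (p : E3 × ℝ) : ℝ :=
  ∑ i, ∑ j, if i < j then (angX i j w p) ^ 2 else 0

/-- The solid light cone `t ≥ |x|`. -/
def cone : Set (E3 × ℝ) := {p | ‖p.1‖ ≤ p.2}

/-- `u` is a C² solution of the Goursat problem for `q` on the cone `t ≥ |x|`:
`∂_t²u − Δu − q u = 0` for `t > |x|` and `u(x,|x|) = ∫₀¹ q(σx) dσ`. -/
def GoursatSol (q : E3 → ℝ) (u : E3 × ℝ → ℝ) : Prop :=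
  ContDiffOn ℝ 2 u cone ∧
  (∀ p : E3 × ℝ, ‖p.1‖ < p.2 → pdt (pdt u) p - lapX u p - q p.1 * u p = 0) ∧
  (∀ x : E3, u (x, ‖x‖) = ∫ σ in (0:ℝ)..1, q (σ • x))

/-- `p(x) = ∫₀^{|x|} q(σ x/|x|) dσ`. -/
def pfun (q : E3 → ℝ) (x : E3) : ℝ := ∫ σ in (0:ℝ)..‖x‖, q ((σ / ‖x‖) • x)

/-- Integral over the sphere of radius `r` with respect to surface measure. -/
def sphInt (r : ℝ) (g : E3 → ℝ) : ℝ := ∫ x in sphere (0:E3) r, g x ∂μH[2]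

/-- Squared `L²` norm on the sphere of radius `r`. -/
def L2sq (g : E3 → ℝ) (r : ℝ) : ℝ := sphInt r (fun x => (g x) ^ 2)

/-- Squared `H¹` norm on the sphere of radius `r`. -/
def H1sq (g : E3 → ℝ) (r : ℝ) : ℝ := sphInt r (fun x => (g x) ^ 2 + (r ^ 2)⁻¹ * angsq g x)

/-- Squared `H²` norm on the sphere of radius `r`. -/
def H2sq (g : E3 → ℝ) (r : ℝ) : ℝ := H1sq g r + sphInt r (fun x => (r ^ 4)⁻¹ * angsq2 g x)

/-- The class `Q_γ(R,T)`. -/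
def memQ (R T γ : ℝ) (q : E3 → ℝ) : Prop :=
  ∀ r ∈ Icc R ((R + T) / 2),
    Real.sqrt (H2sq (pfun q) r) + Real.sqrt (H1sq (pdr (pfun q)) r) ≤
      γ * (Real.sqrt (H1sq (pfun q) r) + Real.sqrt (L2sq (pdr (pfun q)) r))

/-- The closed annulus `R ≤ |x| ≤ ρ` in `ℝ³`. -/
def Ann (R ρ : ℝ) : Set E3 := {x | R ≤ ‖x‖ ∧ ‖x‖ ≤ ρ}

/-- The space-time region `K_ρ = {R ≤ |x| ≤ ρ, |x| ≤ t ≤ R+T−|x|}`. -/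
def Kreg (R T ρ : ℝ) : Set (E3 × ℝ) :=
  {p | R ≤ ‖p.1‖ ∧ ‖p.1‖ ≤ ρ ∧ ‖p.1‖ ≤ p.2 ∧ p.2 ≤ R + T - ‖p.1‖}

/-- `F = ∂_t²w − ∂_r∂_r w − |x|^{-2} Ω w`. -/
def Fop (w : E3 × ℝ → ℝ) (p : E3 × ℝ) : ℝ :=
  pdt (pdt w) p - pdrX (pdrX w) p - (‖p.1‖ ^ 2)⁻¹ * angLapX w p

/-- The sideways energy `J(ρ)`. -/
def Jfun (R T : ℝ) (w : E3 × ℝ → ℝ) (ρ : ℝ) : ℝ :=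
  ∫ t in ρ..(R + T - ρ), sphInt ρ
    (fun x => (ρ ^ 2)⁻¹ * ((w (x, t)) ^ 2 + (pdt w (x, t)) ^ 2 + gradsqX w (x, t)))

/-- The radial unit field, as a space-time vector field. -/
def radialField (z : E3 × ℝ) : E3 × ℝ := (‖z.1‖⁻¹ • z.1, 0)

/-- The rotation field generating `Ω_{ij}`, as a space-time vector field. -/
def angField (i j : Fin 3) (z : E3 × ℝ) : E3 × ℝ :=
  (z.1 i • basis3 j - z.1 j • basis3 i, 0)

lemma pd_fixT {u : E3 × ℝ → ℝ} {p : E3 × ℝ} (hu : DifferentiableAt ℝ u p) (i : Fin 3) :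
    pd i (fixT u p.2) p.1 = fderiv ℝ u p (basis3 i, 0) := by
  have h : HasFDerivAt (fixT u p.2) ((fderiv ℝ u p).comp (.inl ℝ E3 ℝ)) p.1 :=
    HasFDerivAt.comp (f := fun y : E3 => (y, p.2)) p.1 hu.hasFDerivAt
      (hasFDerivAt_prodMk_left p.1 p.2)
  simp [pd, h.fderiv]

lemma sum_smul_basis3 (x : E3) : ∑ i, x i • basis3 i = x := by
  ext j
  fin_cases j <;> simp [Fin.sum_univ_three, basis3]

lemma pdrX_eq_fderiv {u : E3 × ℝ → ℝ} {p : E3 × ℝ} (hu : DifferentiableAt ℝ u p) :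
    pdrX u p = fderiv ℝ u p (radialField p) := by
  have h : radialField p = ‖p.1‖⁻¹ • ∑ i, p.1 i • ((basis3 i, 0) : E3 × ℝ) := by
    refine Prod.ext ?_ ?_
    · simp [radialField, Prod.fst_sum, sum_smul_basis3]
    · simp [radialField, Prod.snd_sum]
  simp only [pdrX, pdr, pd_fixT hu, h, map_smul, map_sum, smul_eq_mul]

lemma angX_eq_fderiv {u : E3 × ℝ → ℝ} {p : E3 × ℝ} (hu : DifferentiableAt ℝ u p)
    (i j : Fin 3) : angX i j u p = fderiv ℝ u p (angField i j p) := by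
  have h : angField i j p =
      p.1 i • ((basis3 j, 0) : E3 × ℝ) - p.1 j • ((basis3 i, 0) : E3 × ℝ) := by
    simp [angField]
  simp only [angX, ang, pd_fixT hu, h, map_smul, map_sub, smul_eq_mul]

lemma differentiableAt_radialField {p : E3 × ℝ} (hp : p.1 ≠ 0) :
    DifferentiableAt ℝ radialField p := by
  have h : DifferentiableAt ℝ (fun z : E3 × ℝ => ‖z.1‖) p := differentiableAt_fst.norm ℝ hp
  have h0 : ‖p.1‖ ≠ 0 := norm_ne_zero_iff.mpr hp
  exact ((h.inv h0).smul differentiableAt_fst).prodMk (differentiableAt_const 0)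

lemma differentiableAt_angField (i j : Fin 3) (p : E3 × ℝ) :
    DifferentiableAt ℝ (angField i j) p := by
  unfold angField
  fun_prop

lemma hasDerivAt_slice {u : E3 × ℝ → ℝ} {p : E3 × ℝ} (hu : DifferentiableAt ℝ u p) :
    HasDerivAt (fun s => u (p.1, s)) (pdt u p) p.2 :=
  HasFDerivAt.comp_hasDerivAt (f := fun s : ℝ => (p.1, s)) p.2 hu.hasFDerivAt
    ((hasDerivAt_const p.2 p.1).prodMk (hasDerivAt_id p.2))

section SecondOrder

variable {w : E3 × ℝ → ℝ} {p : E3 × ℝ}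

lemma ContDiffAt.eventually_differentiableAt_of_two (hw : ContDiffAt ℝ 2 w p) :
    ∀ᶠ z in nhds p, DifferentiableAt ℝ w z :=
  (hw.eventually (by simp)).mono fun _ h => h.differentiableAt (by simp)

lemma ContDiffAt.differentiableAt_fderiv_of_two (hw : ContDiffAt ℝ 2 w p) :
    DifferentiableAt ℝ (fderiv ℝ w) p :=
  (hw.fderiv_right (m := 1) (by norm_num)).differentiableAt (by simp)

lemma ContDiffAt.differentiableAt_pdt (hw : ContDiffAt ℝ 2 w p) :
    DifferentiableAt ℝ (pdt w) p :=
  hw.differentiableAt_fderiv_of_two.clm_apply (differentiableAt_const (0, 1))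

lemma ContDiffAt.differentiableAt_pdrX (hw : ContDiffAt ℝ 2 w p) (hp : p.1 ≠ 0) :
    DifferentiableAt ℝ (pdrX w) p :=
  (hw.differentiableAt_fderiv_of_two.clm_apply
    (differentiableAt_radialField hp)).congr_of_eventuallyEq
    (hw.eventually_differentiableAt_of_two.mono fun _ h => pdrX_eq_fderiv h)

lemma ContDiffAt.differentiableAt_angX (hw : ContDiffAt ℝ 2 w p) (i j : Fin 3) :
    DifferentiableAt ℝ (angX i j w) p :=
  (hw.differentiableAt_fderiv_of_two.clm_apply
    (differentiableAt_angField i j p)).congr_of_eventuallyEq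
    (hw.eventually_differentiableAt_of_two.mono fun _ h => angX_eq_fderiv h i j)

/-- `∂_t` commutes with differentiation along a time-independent field. -/
lemma ContDiffAt.pdt_fderiv_apply (hw : ContDiffAt ℝ 2 w p) {V : E3 × ℝ → E3 × ℝ}
    (hV : DifferentiableAt ℝ V p) (hVt : ∀ s, V (p.1, s) = V p) :
    pdt (fun z => fderiv ℝ w z (V z)) p = fderiv ℝ (pdt w) p (V p) := by
  have hd := hw.differentiableAt_fderiv_of_two
  have hV0 : fderiv ℝ V p (0, 1) = 0 := by
    have h : HasDerivAt (fun s => V (p.1, s)) (fderiv ℝ V p (0, 1)) p.2 :=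
      HasFDerivAt.comp_hasDerivAt (f := fun s : ℝ => (p.1, s)) p.2 hV.hasFDerivAt
        ((hasDerivAt_const p.2 p.1).prodMk (hasDerivAt_id p.2))
    simp only [hVt] at h
    exact h.unique (hasDerivAt_const _ _)
  have hsymm : IsSymmSndFDerivAt ℝ w p := hw.isSymmSndFDerivAt (by simp)
  have h1 := hd.hasFDerivAt.clm_apply hV.hasFDerivAt
  have h2 := hd.hasFDerivAt.clm_apply (hasFDerivAt_const ((0, 1) : E3 × ℝ) p)
  have h2' : fderiv ℝ (pdt w) p = _ := h2.fderiv
  rw [pdt, h1.fderiv, h2']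
  simp [hV0, hsymm.eq (0, 1) (V p)]

lemma ContDiffAt.pdt_pdrX (hw : ContDiffAt ℝ 2 w p) (hp : p.1 ≠ 0) :
    pdt (pdrX w) p = pdrX (pdt w) p := by
  have h : pdrX w =ᶠ[nhds p] fun z => fderiv ℝ w z (radialField z) :=
    hw.eventually_differentiableAt_of_two.mono fun _ h => pdrX_eq_fderiv h
  rw [pdrX_eq_fderiv hw.differentiableAt_pdt,
    ← hw.pdt_fderiv_apply (differentiableAt_radialField hp) fun _ => rfl, pdt, h.fderiv_eq, pdt]

lemma ContDiffAt.pdt_angX (hw : ContDiffAt ℝ 2 w p) (i j : Fin 3) :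
    pdt (angX i j w) p = angX i j (pdt w) p := by
  have h : angX i j w =ᶠ[nhds p] fun z => fderiv ℝ w z (angField i j z) :=
    hw.eventually_differentiableAt_of_two.mono fun _ h => angX_eq_fderiv h i j
  rw [angX_eq_fderiv hw.differentiableAt_pdt,
    ← hw.pdt_fderiv_apply (differentiableAt_angField i j p) fun _ => rfl, pdt, h.fderiv_eq, pdt]

end SecondOrder

lemma pdrX_mul {u v : E3 × ℝ → ℝ} {p : E3 × ℝ} (hu : DifferentiableAt ℝ u p)
    (hv : DifferentiableAt ℝ v p) :
    pdrX (fun z => u z * v z) p = u p * pdrX v p + v p * pdrX u p := by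
  rw [pdrX_eq_fderiv (hu.fun_mul hv), pdrX_eq_fderiv hu, pdrX_eq_fderiv hv, fderiv_fun_mul hu hv]
  simp

lemma angX_mul {u v : E3 × ℝ → ℝ} {p : E3 × ℝ} (hu : DifferentiableAt ℝ u p)
    (hv : DifferentiableAt ℝ v p) (i j : Fin 3) :
    angX i j (fun z => u z * v z) p = u p * angX i j v p + v p * angX i j u p := by
  rw [angX_eq_fderiv (hu.fun_mul hv), angX_eq_fderiv hu, angX_eq_fderiv hv, fderiv_fun_mul hu hv]
  simp

lemma sum_sum_ite_lt_fin_three (f : Fin 3 → Fin 3 → ℝ) :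
    (∑ i, ∑ j, if i < j then f i j else 0) = f 0 1 + f 0 2 + f 1 2 := by
  simp [Fin.sum_univ_three]

/-- **identity (2.9).** The pointwise standard-energy identity. -/
theorem stmt12 (S : Set (E3 × ℝ)) (hS : IsOpen S) (hS0 : ∀ p ∈ S, p.1 ≠ 0)
    (w : E3 × ℝ → ℝ) (hw : ContDiffOn ℝ 2 w S) (p : E3 × ℝ) (hp : p ∈ S) :
    2 * pdt w p *
        (pdt (pdt w) p - pdrX (pdrX w) p - (‖p.1‖ ^ 2)⁻¹ * angLapX w p + w p)
    = pdt (fun z => (w z) ^ 2 + (pdt w z) ^ 2 + (pdrX w z) ^ 2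
          + (‖z.1‖ ^ 2)⁻¹ * angsqX w z) p
      - 2 * pdrX (fun z => pdt w z * pdrX w z) p
      - 2 * (‖p.1‖ ^ 2)⁻¹ * (∑ k, ∑ l, if k < l then
          angX k l (fun z => pdt w z * angX k l w z) p else 0) := by
  have hw2 : ContDiffAt ℝ 2 w p := hw.contDiffAt (hS.mem_nhds hp)
  have hp0 : p.1 ≠ 0 := hS0 p hp
  have dw : DifferentiableAt ℝ w p := hw2.differentiableAt (by simp)
  have dt := hw2.differentiableAt_pdt
  have dr := hw2.differentiableAt_pdrX hp0
  have da := hw2.differentiableAt_angX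
  have dn : DifferentiableAt ℝ (fun z : E3 × ℝ => (‖z.1‖ ^ 2)⁻¹) p :=
    ((differentiableAt_fst.norm ℝ hp0).pow 2).inv (pow_ne_zero 2 (norm_ne_zero_iff.mpr hp0))
  have hΩ : angLapX w p = angX 0 1 (angX 0 1 w) p + angX 0 2 (angX 0 2 w) p
      + angX 1 2 (angX 1 2 w) p :=
    sum_sum_ite_lt_fin_three fun i j => angX i j (angX i j w) p
  have hsq : angsqX w = fun z => angX 0 1 w z ^ 2 + angX 0 2 w z ^ 2 + angX 1 2 w z ^ 2 :=
    funext fun z => sum_sum_ite_lt_fin_three fun i j => angX i j w z ^ 2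
  have dF : DifferentiableAt ℝ (fun z => (w z) ^ 2 + (pdt w z) ^ 2 + (pdrX w z) ^ 2
      + (‖z.1‖ ^ 2)⁻¹ * angsqX w z) p := by
    rw [hsq]
    exact (((dw.pow 2).add (dt.pow 2)).add (dr.pow 2)).add
      (dn.mul ((((da 0 1).pow 2).add ((da 0 2).pow 2)).add ((da 1 2).pow 2)))
  have hF := ((((hasDerivAt_slice dw).pow 2).add ((hasDerivAt_slice dt).pow 2)).add
    ((hasDerivAt_slice dr).pow 2)).add
      (((((hasDerivAt_slice (da 0 1)).pow 2).add ((hasDerivAt_slice (da 0 2)).pow 2)).add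
        ((hasDerivAt_slice (da 1 2)).pow 2)).const_mul (‖p.1‖ ^ 2)⁻¹)
  have hF' := hasDerivAt_slice dF
  rw [hsq] at hF'
  rw [sum_sum_ite_lt_fin_three, hΩ, hsq, hF'.unique hF, pdrX_mul dt dr, angX_mul dt (da 0 1),
    angX_mul dt (da 0 2), angX_mul dt (da 1 2), hw2.pdt_pdrX hp0, hw2.pdt_angX, hw2.pdt_angX,
    hw2.pdt_angX]
  simp only [Prod.mk.eta]
  ring
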